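/- Let X ⊆ ℂ be bounded, V a simply connected open neighborhood of closure(X), f entire with no singular values in V \ X̂, and U a bounded connected component of f⁻¹(V). Assume f⁻¹(X) ∩ U has finitely many components, each compactly contained in U, and write f_U⁻¹(A) := f⁻¹(A) ∩ U for A ⊆ V. Then \widehat{f_U⁻¹(X)} = f_U⁻¹(X̂). -/

import Mathlib

open Set Topology Bornology Filter Metric

noncomputable section

/-- The "hat" of a bounded set: its closure together with all bounded connected
components of the complement of its closure. -/
def hat (X : Set ℂ) : Set ℂ :=
  closure X ∪ {z | z ∉ closure X ∧ IsBounded (connectedComponentIn (closure X)ᶜ z)}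

/-- The ω-limit set of the orbit of `x` under `f`. -/
def omegaSet (f : ℂ → ℂ) (x : ℂ) : Set ℂ :=
  {y | MapClusterPt y atTop fun n => f^[n] x}

/-- `v` is a singular value of `f`: on no open neighborhood of `v` are all branches of
the inverse well defined and univalent. -/
def IsSingularValue (f : ℂ → ℂ) (v : ℂ) : Prop :=
  ∀ V : Set ℂ, IsOpen V → v ∈ V →
    ∃ x ∈ f ⁻¹' V, ¬ (Set.InjOn f (connectedComponentIn (f ⁻¹' V) x) ∧
      f '' connectedComponentIn (f ⁻¹' V) x = V)

/-- The Fatou set: points near which the family of iterates is normal (equicontinuous). -/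
def fatouSet (f : ℂ → ℂ) : Set ℂ :=
  {z | ∃ U ∈ 𝓝 z, IsOpen U ∧ EquicontinuousOn (fun n : ℕ => f^[n]) U}

/-- `φ` is a biholomorphism from `A` onto `B`. -/
def Biholo (φ : ℂ → ℂ) (A B : Set ℂ) : Prop :=
  DifferentiableOn ℂ φ A ∧ Set.InjOn φ A ∧ φ '' A = B

/-- `Δ` is a forward invariant Siegel disk of `f` with rotation number `θ`. -/
def IsSiegelDisk (f : ℂ → ℂ) (Δ : Set ℂ) (θ : ℝ) : Prop :=
  IsOpen Δ ∧ IsConnected Δ ∧ f '' Δ = Δ ∧ Δ ⊆ fatouSet f ∧ Irrational θ ∧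
  ∃ φ : ℂ → ℂ, Biholo φ (Metric.ball 0 1) Δ ∧
    ∀ z ∈ Metric.ball (0:ℂ) 1,
      f (φ z) = φ (Complex.exp (2 * Real.pi * θ * Complex.I) * z)

/-- `U` is a connected component of the Fatou set of `f`. -/
def IsFatouComponent (f : ℂ → ℂ) (U : Set ℂ) : Prop :=
  ∃ z ∈ fatouSet f, U = connectedComponentIn (fatouSet f) z

/-- A periodic Fatou component. -/
def IsPeriodicFatouComponent (f : ℂ → ℂ) (U : Set ℂ) : Prop :=
  IsFatouComponent f U ∧ ∃ n : ℕ, 0 < n ∧ f^[n] '' U ⊆ U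

/-- The Separation Property: closures of any two distinct periodic Fatou components
intersect in at most one point. -/
def SeparationProperty (f : ℂ → ℂ) : Prop :=
  ∀ U V : Set ℂ, IsPeriodicFatouComponent f U → IsPeriodicFatouComponent f V →
    U ≠ V → (closure U ∩ closure V).Subsingleton

/-- A wandering domain: a Fatou component whose forward images lie in pairwise
distinct Fatou components. -/
def IsWanderingDomain (f : ℂ → ℂ) (U : Set ℂ) : Prop :=
  IsFatouComponent f U ∧
  ∀ m n : ℕ, m < n → ∀ z ∈ U,
    connectedComponentIn (fatouSet f) (f^[m] z) ≠ connectedComponentIn (fatouSet f) (f^[n] z)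

/-- Only the finite set `S` of singular values interacts with the Siegel disk `Δ`. -/
def InteractingSingularSet (f : ℂ → ℂ) (Δ : Set ℂ) (S : Set ℂ) : Prop :=
  S.Finite ∧ S ⊆ {v | IsSingularValue f v} ∧
  (∀ s ∈ S, (omegaSet f s ∩ hat Δ).Nonempty) ∧
  closure (⋃ s ∈ {v | IsSingularValue f v} \ S, omegaSet f s) ∩ hat Δ = ∅ ∧
  closure ({v | IsSingularValue f v} \ S) ∩ frontier Δ = ∅

/-- `θ` is a Herman number: every analytic orientation preserving circle diffeomorphism
(given by its lift) with rotation number `θ` is analytically linearizable. -/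
def IsHermanNumber (θ : ℝ) : Prop :=
  ∀ F : ℝ → ℝ, AnalyticOnNhd ℝ F Set.univ → StrictMono F →
    (∀ x, F (x + 1) = F x + 1) → (∀ x, 0 < deriv F x) →
    (∀ x : ℝ, Filter.Tendsto (fun n : ℕ => (F^[n] x - x) / n) Filter.atTop (nhds θ)) →
    ∃ H : ℝ → ℝ, AnalyticOnNhd ℝ H Set.univ ∧ StrictMono H ∧
      (∀ x, H (x + 1) = H x + 1) ∧ ∀ x, H (F x) = H x + θ

/-- `f` restricted to `U` is a holomorphic covering of `V`. -/
def IsHolCoveringOn (f : ℂ → ℂ) (U V : Set ℂ) : Prop :=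
  DifferentiableOn ℂ f U ∧ f '' U = V ∧
  ∀ v ∈ V, ∃ W, IsOpen W ∧ v ∈ W ∧ W ⊆ V ∧
    ∀ x ∈ U ∩ f ⁻¹' W, Set.BijOn f (connectedComponentIn (U ∩ f ⁻¹' W) x) W

/-- The frontier of a component of the complement of a closed set lies in that set. -/
theorem frontier_connectedComponentIn_compl_subset {K : Set ℂ} (hK : IsClosed K) (z : ℂ) :
    frontier (connectedComponentIn Kᶜ z) ⊆ K := by
  intro x hx
  by_contra hxK
  rw [hK.isOpen_compl.connectedComponentIn.frontier_eq] at hx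
  obtain ⟨y, hyx, hyz⟩ := mem_closure_iff.1 hx.1 _ hK.isOpen_compl.connectedComponentIn
    (mem_connectedComponentIn (show x ∈ Kᶜ from hxK))
  refine hx.2 ?_
  rw [connectedComponentIn_eq hyz, ← connectedComponentIn_eq hyx]
  exact mem_connectedComponentIn hxK

/-- There is no continuous logarithm of the identity on a circle around the origin. -/
theorem not_exists_continuous_log_circle (p : ℂ) {R : ℝ} (h : ℂ → ℂ)
    (hh : Continuous h)
    (hexp : ∀ t : ℝ, Complex.exp (h (p + R * Complex.exp (t * Complex.I))) =
      R * Complex.exp (t * Complex.I)) : False := by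
  have key := Complex.isCoveringMap_exp.eq_of_comp_eq (A := ℝ)
    (g₁ := fun t : ℝ ↦ h (p + R * Complex.exp (t * Complex.I)))
    (g₂ := fun t : ℝ ↦ h (p + R) + t * Complex.I)
    (by fun_prop) (by fun_prop) ?_ 0 (by simp)
  · have h2 := congrFun key (2 * Real.pi)
    simp [Complex.exp_two_pi_mul_I, Real.pi_ne_zero] at h2
  · funext t
    have h0 := hexp 0
    simp only [Complex.ofReal_zero, zero_mul, Complex.exp_zero, mul_one] at h0
    simp [Complex.exp_add, hexp t, h0]

/-- A simply connected open set containing a closed set `K` contains every bounded component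
of the complement of `K`. -/
theorem mem_of_isBounded_connectedComponentIn_compl {K V : Set ℂ} (hK : IsClosed K)
    (hV : IsOpen V) (hVsc : IsSimplyConnected V) (hKV : K ⊆ V) {p : ℂ} (hpK : p ∉ K)
    (hb : IsBounded (connectedComponentIn Kᶜ p)) : p ∈ V := by
  classical
  by_contra hpV
  set D := connectedComponentIn Kᶜ p with hD
  have hpD : p ∈ D := mem_connectedComponentIn hpK
  have hfr : frontier D ⊆ K := frontier_connectedComponentIn_compl_subset hK p
  obtain ⟨g, hgc, hg⟩ := Complex.exists_continuousOn_eqOn_exp_comp hVsc hV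
    (g := fun z ↦ z - p) (by fun_prop) (by
      rintro ⟨z, hz, hzp⟩
      exact hpV (sub_eq_zero.1 hzp ▸ hz))
  obtain ⟨G, hG⟩ := ContinuousMap.exists_restrict_eq hK
    (⟨K.domRestrict g, continuousOn_iff_continuous_domRestrict.1 (hgc.mono hKV)⟩ : C(K, ℂ))
  have hGg : ∀ x ∈ K, G x = g x := fun x hx ↦ DFunLike.congr_fun hG ⟨x, hx⟩
  set F : ℂ → ℂ := D.piecewise (fun z ↦ Complex.exp (G z)) (fun z ↦ z - p) with hF
  have hFc : Continuous F := by
    refine Continuous.piecewise (fun a ha ↦ ?_) (by fun_prop) (by fun_prop)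
    rw [hGg a (hfr ha)]
    exact hg (hKV (hfr ha))
  have hF0 : ∀ z, F z ≠ 0 := by
    intro z
    by_cases hz : z ∈ D
    · simp [hF, hz, Complex.exp_ne_zero]
    · simp only [hF, hz, piecewise_eq_of_notMem, not_false_eq_true]
      exact fun h ↦ hz (sub_eq_zero.1 h ▸ hpD)
  obtain ⟨L, hLc, hL⟩ := Complex.exists_continuousOn_eqOn_exp_comp (U := (univ : Set ℂ))
    (Homeomorph.Set.univ ℂ).toHomotopyEquiv.simplyConnectedSpace isOpen_univ hFc.continuousOn
    (by rintro ⟨z, -, hz⟩; exact hF0 z hz)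
  obtain ⟨R, hR0, hR⟩ := hb.subset_ball_lt 0 p
  refine not_exists_continuous_log_circle p (R := R) L (continuousOn_univ.1 hLc) fun t ↦ ?_
  have hnot : p + R * Complex.exp (t * Complex.I) ∉ D := fun hmem ↦ by
    have := hR hmem
    simp [Complex.norm_exp_ofReal_mul_I, abs_of_pos hR0] at this
  have := hL (mem_univ (p + R * Complex.exp (t * Complex.I)))
  simpa [hF, hnot] using this

/-- The image of a bounded open set whose frontier is sent into a set `K` only meets the
bounded components of the complement of `K`, besides `K` itself. -/
theorem isBounded_connectedComponentIn_of_frontier_image_subset {K C : Set ℂ} {f : ℂ → ℂ}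
    (hf : Continuous f) (hfo : IsOpenMap f) (hC : IsOpen C) (hCb : IsBounded C)
    (hfr : f '' frontier C ⊆ K) {c : ℂ} (hc : c ∈ C) (hcK : f c ∉ K) :
    IsBounded (connectedComponentIn Kᶜ (f c)) := by
  have hcomp : IsCompact (f '' closure C) := hCb.isCompact_closure.image hf
  refine (hcomp.isBounded.subset (image_mono subset_closure)).subset (t := f '' C) ?_
  refine isPreconnected_connectedComponentIn.subset_of_closure_inter_subset (hfo _ hC)
    ⟨f c, mem_connectedComponentIn hcK, mem_image_of_mem f hc⟩ ?_
  rintro w ⟨hw, hwK⟩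
  obtain ⟨z, hz, rfl⟩ := hcomp.isClosed.closure_subset_iff.2 (image_mono subset_closure) hw
  by_cases hzC : z ∈ C
  · exact mem_image_of_mem f hzC
  · refine absurd (hfr (mem_image_of_mem f ?_)) (connectedComponentIn_subset _ _ hwK)
    rw [hC.frontier_eq]
    exact ⟨hz, hzC⟩

/-- A connected component of a set is relatively closed in that set. -/
theorem closure_connectedComponentIn_inter_subset {α : Type*} [TopologicalSpace α] {S : Set α}
    (z : α) : closure (connectedComponentIn S z) ∩ S ⊆ connectedComponentIn S z := by
  rintro x ⟨hx, hxS⟩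
  have hz : z ∈ S := by
    by_contra hz
    simp [connectedComponentIn_eq_empty hz] at hx
  refine (isPreconnected_connectedComponentIn.subset_closure (t := insert x (connectedComponentIn S z))
    (subset_insert _ _) (insert_subset hx subset_closure)).subset_connectedComponentIn
    (mem_insert_of_mem _ (mem_connectedComponentIn hz))
    (insert_subset hxS (connectedComponentIn_subset S z)) (mem_insert _ _)

/-- On a connected component `U` of `f ⁻¹' V`, the closure of the preimage is the preimage
of the closure. -/
theorem closure_preimage_inter_connectedComponentIn {X V : Set ℂ} {f : ℂ → ℂ}
    (hf : Continuous f) (hfo : IsOpenMap f) (hV : IsOpen V) (hXV : closure X ⊆ V) (z : ℂ) :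
    closure (f ⁻¹' X ∩ connectedComponentIn (f ⁻¹' V) z) =
      f ⁻¹' closure X ∩ connectedComponentIn (f ⁻¹' V) z := by
  apply Subset.antisymm
  · intro x hx
    have hxX : f x ∈ closure X :=
      closure_minimal (inter_subset_left.trans (preimage_mono subset_closure))
        (isClosed_closure.preimage hf) hx
    exact ⟨hxX, closure_connectedComponentIn_inter_subset z
      ⟨closure_mono inter_subset_right hx, hXV hxX⟩⟩
  · rw [hfo.preimage_closure_eq_closure_preimage hf, inter_comm, inter_comm (f ⁻¹' X)]
    exact (hV.preimage hf).connectedComponentIn.inter_closure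

/-- Proposition 2.6(3): the hat of the preimage equals the preimage of
the hat. -/
theorem stmt16 (X V : Set ℂ) (hX : IsBounded X) (hV : IsOpen V)
    (hVsc : SimplyConnectedSpace V) (hXV : closure X ⊆ V)
    (f : ℂ → ℂ) (hf : Differentiable ℂ f)
    (hsing : ∀ v ∈ V \ hat X, ¬ IsSingularValue f v)
    (U : Set ℂ) (hUb : IsBounded U)
    (hUcomp : ∃ z ∈ f ⁻¹' V, U = connectedComponentIn (f ⁻¹' V) z)
    (hfin : {C : Set ℂ | ∃ x ∈ f ⁻¹' X ∩ U, C = connectedComponentIn (f ⁻¹' X ∩ U) x}.Finite)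
    (hcc : ∀ x ∈ f ⁻¹' X ∩ U, closure (connectedComponentIn (f ⁻¹' X ∩ U) x) ⊆ U) :
    hat (f ⁻¹' X ∩ U) = f ⁻¹' hat X ∩ U := by
  obtain ⟨z₀, hz₀, rfl⟩ := hUcomp
  set U := connectedComponentIn (f ⁻¹' V) z₀ with hU
  have hfo : IsOpenMap f := by
    refine (Complex.analyticOnNhd_univ_iff_differentiable.2 hf |>.is_constant_or_isOpenMap).resolve_left ?_
    rintro ⟨w, hw⟩
    have huniv : f ⁻¹' V = univ := eq_univ_of_forall fun z ↦ by
      rw [mem_preimage, hw z, ← hw z₀]; exact hz₀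
    rw [hU, huniv, connectedComponentIn_univ, PreconnectedSpace.connectedComponent_eq_univ] at hUb
    exact NormedSpace.unbounded_univ ℝ ℂ hUb
  have hfc := hf.continuous
  have hUo : IsOpen U := (hV.preimage hfc).connectedComponentIn
  have hcl : closure (f ⁻¹' X ∩ U) = f ⁻¹' closure X ∩ U :=
    closure_preimage_inter_connectedComponentIn hfc hfo hV hXV z₀
  ext z
  simp only [hat, mem_union, mem_ofPred_eq, mem_inter_iff, mem_preimage, hcl]
  constructor
  · rintro (hz | ⟨hz, hb⟩)
    · exact ⟨.inl hz.1, hz.2⟩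
    set L := f ⁻¹' closure X ∩ U with hL
    have hLc : IsClosed L := hcl ▸ isClosed_closure
    set C := connectedComponentIn Lᶜ z with hC
    have hzC : z ∈ C := mem_connectedComponentIn hz
    have hfr : frontier C ⊆ L := frontier_connectedComponentIn_compl_subset hLc z
    have himg (c : ℂ) (hc : c ∈ C) (hcX : f c ∉ closure X) :
        IsBounded (connectedComponentIn (closure X)ᶜ (f c)) :=
      isBounded_connectedComponentIn_of_frontier_image_subset hfc hfo
        hLc.isOpen_compl.connectedComponentIn hb
        ((image_mono hfr).trans (image_subset_iff.2 inter_subset_left)) hc hcX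
    have hCV : C ⊆ f ⁻¹' V := fun c hc ↦ by
      by_cases hcX : f c ∈ closure X
      · exact hXV hcX
      · exact mem_of_isBounded_connectedComponentIn_compl isClosed_closure hV hVsc hXV hcX
          (himg c hc hcX)
    obtain ⟨y, hy⟩ : (frontier C).Nonempty := nonempty_frontier_iff.2
      ⟨⟨z, hzC⟩, fun h ↦ NormedSpace.unbounded_univ ℝ ℂ (h ▸ hb)⟩
    have hclV : closure C ⊆ f ⁻¹' V := by
      rw [closure_eq_self_union_frontier]
      exact union_subset hCV (hfr.trans fun x hx ↦ hXV hx.1)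
    have hzU : z ∈ U := by
      rw [hU, connectedComponentIn_eq (hfr hy).2]
      exact isPreconnected_connectedComponentIn.closure.subset_connectedComponentIn
        (frontier_subset_closure hy) hclV (subset_closure hzC)
    have hzX : f z ∉ closure X := fun h ↦ hz ⟨h, hzU⟩
    exact ⟨.inr ⟨hzX, himg z hzC hzX⟩, hzU⟩
  · rintro ⟨hz | ⟨hz, hb⟩, hzU⟩
    · exact .inl ⟨hz, hzU⟩
    refine .inr ⟨fun h ↦ hz h.1, ?_⟩
    set W := connectedComponentIn (closure X)ᶜ (f z) with hW
    have hWV : closure W ⊆ V := by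
      rw [closure_eq_self_union_frontier]
      refine union_subset (fun w hw ↦ ?_)
        ((frontier_connectedComponentIn_compl_subset isClosed_closure _).trans hXV)
      refine mem_of_isBounded_connectedComponentIn_compl isClosed_closure hV hVsc hXV
        (connectedComponentIn_subset _ _ hw) ?_
      rwa [← connectedComponentIn_eq hw]
    have hWo : IsOpen W := isClosed_closure.isOpen_compl.connectedComponentIn
    refine hUb.subset (subset_trans ?_ (inter_subset_right (s := f ⁻¹' W)))
    refine isPreconnected_connectedComponentIn.subset_of_closure_inter_subset
      ((hWo.preimage hfc).inter hUo)
      ⟨z, mem_connectedComponentIn fun h ↦ hz h.1, mem_connectedComponentIn hz, hzU⟩ ?_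
    rintro x ⟨hx, hxL⟩
    rw [closure_preimage_inter_connectedComponentIn hfc hfo hV hWV z₀] at hx
    refine ⟨?_, hx.2⟩
    refine closure_connectedComponentIn_inter_subset _ ⟨hx.1, fun hxX ↦ ?_⟩
    exact connectedComponentIn_subset _ _ hxL ⟨hxX, hx.2⟩
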